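/- arXiv:2006.13105 — 2 statements merged into one kernel-verified Lean document; each statement's English description precedes it below -/
import Mathlib

section
/- For all reals a < m < b and every real power n > 1, the function F_TSP(·; a, m, b, n) is differentiable at every point u ∈ ℝ, with derivative equal to f_TSP(u; a, m, b, n). -/
/-- The two-sided power (TSP) cumulative distribution function with parameters
`a < m < b` and power `n`. -/
noncomputable def Ftsp (a m b n : ℝ) (u : ℝ) : ℝ :=
  if u ≤ a then 0
  else if u ≤ m then ((m - a) / (b - a)) * (((u - a) / (m - a)) ^ n)
  else if u ≤ b then 1 - ((b - m) / (b - a)) * (((b - u) / (b - m)) ^ n)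
  else 1

/-- The two-sided power (TSP) probability density function with parameters
`a < m < b` and power `n`. -/
noncomputable def ftsp (a m b n : ℝ) (u : ℝ) : ℝ :=
  if a < u ∧ u ≤ m then (n / (b - a)) * (((u - a) / (m - a)) ^ (n - 1))
  else if m ≤ u ∧ u < b then (n / (b - a)) * (((b - u) / (b - m)) ^ (n - 1))
  else 0

theorem glue_hasDerivAt (F g h : ℝ → ℝ) (d u l r : ℝ) (hl : l < u) (hr : u < r)
    (hg : HasDerivAt g d u) (hh : HasDerivAt h d u)
    (hFg : ∀ x, l < x → x ≤ u → F x = g x) (hFh : ∀ x, u ≤ x → x < r → F x = h x) :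
    HasDerivAt F d u := by
  have h1 : HasDerivWithinAt F d (Set.Iic u) u := by
    refine hg.hasDerivWithinAt.congr_of_eventuallyEq ?_ (hFg u hl le_rfl)
    filter_upwards [self_mem_nhdsWithin, mem_nhdsWithin_of_mem_nhds (Ioi_mem_nhds hl)] with x hx hx'
    exact hFg x hx' hx
  have h2 : HasDerivWithinAt F d (Set.Ici u) u := by
    refine hh.hasDerivWithinAt.congr_of_eventuallyEq ?_ (hFh u le_rfl hr)
    filter_upwards [self_mem_nhdsWithin, mem_nhdsWithin_of_mem_nhds (Iio_mem_nhds hr)] with x hx hx'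
    exact hFh x hx hx'
  have h3 := h1.union h2
  rw [Set.Iic_union_Ici] at h3
  exact hasDerivWithinAt_univ.mp h3

/-- For all reals `a < m < b` and every real power `n > 1`, the function
`F_TSP(·; a, m, b, n)` is differentiable at every point `u ∈ ℝ`, with derivative equal
to `f_TSP(u; a, m, b, n)`. -/
theorem Ftsp_hasDerivAt (a m b n : ℝ) (ham : a < m) (hmb : m < b) (hn : 1 < n) :
    ∀ u : ℝ, HasDerivAt (Ftsp a m b n) (ftsp a m b n u) u := by
  intro u
  have hma : m - a ≠ 0 := by linarith
  have hbm : b - m ≠ 0 := by linarith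
  have hba : b - a ≠ 0 := by linarith
  have hn0 : n ≠ 0 := by linarith
  have hn1 : n - 1 ≠ 0 := by linarith
  have hL : HasDerivAt (fun x : ℝ => ((m - a) / (b - a)) * (((x - a) / (m - a)) ^ n))
      ((n / (b - a)) * (((u - a) / (m - a)) ^ (n - 1))) u := by
    have h := ((((hasDerivAt_id u).sub_const a).div_const (m - a)).rpow_const
      (p := n) (Or.inr hn.le)).const_mul ((m - a) / (b - a))
    refine HasDerivAt.congr_deriv h ?_
    simp only [id]
    field_simp
  have hR : HasDerivAt (fun x : ℝ => 1 - ((b - m) / (b - a)) * (((b - x) / (b - m)) ^ n))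
      ((n / (b - a)) * (((b - u) / (b - m)) ^ (n - 1))) u := by
    have h := (((((hasDerivAt_id u).const_sub b).div_const (b - m)).rpow_const
      (p := n) (Or.inr hn.le)).const_mul ((b - m) / (b - a))).const_sub 1
    refine HasDerivAt.congr_deriv h ?_
    simp only [id]
    field_simp
  have h0 : HasDerivAt (fun _ : ℝ => (0 : ℝ)) 0 u := hasDerivAt_const u 0
  have h1 : HasDerivAt (fun _ : ℝ => (1 : ℝ)) 0 u := hasDerivAt_const u 1
  have F0 : ∀ x, x ≤ a → Ftsp a m b n x = 0 := fun x hx => by simp [Ftsp, hx]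
  have FL : ∀ x, a ≤ x → x ≤ m →
      Ftsp a m b n x = ((m - a) / (b - a)) * (((x - a) / (m - a)) ^ n) := by
    intro x hx hx'
    rcases hx.eq_or_lt with rfl | hx
    · simp [Ftsp, Real.zero_rpow hn0]
    · simp [Ftsp, hx.not_ge, hx']
  have FR : ∀ x, m ≤ x → x ≤ b →
      Ftsp a m b n x = 1 - ((b - m) / (b - a)) * (((b - x) / (b - m)) ^ n) := by
    intro x hx hx'
    rcases hx.eq_or_lt with rfl | hx
    · rw [FL _ ham.le le_rfl, div_self hma, div_self hbm, Real.one_rpow]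
      field_simp
      ring
    · simp [Ftsp, hx.not_ge, hx', (ham.trans hx).not_ge]
  have F1 : ∀ x, b ≤ x → Ftsp a m b n x = 1 := by
    intro x hx
    rcases hx.eq_or_lt with rfl | hx
    · rw [FR _ hmb.le le_rfl]
      simp [Real.zero_rpow hn0]
    · simp [Ftsp, hx.not_ge, (hmb.trans hx).not_ge, (ham.trans (hmb.trans hx)).not_ge]
  rcases lt_trichotomy u a with h | h | h
  · have e : ftsp a m b n u = 0 := by
      simp [ftsp, h.le.not_gt, (h.trans ham).not_ge]
    rw [e]
    exact glue_hasDerivAt _ _ _ _ u (u - 1) a (by linarith) h h0 h0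
      (fun x _ _ => F0 x (by linarith)) (fun x _ _ => F0 x (by linarith))
  · have e : ftsp a m b n u = 0 := by
      simp [ftsp, h, ham.not_ge]
    have e' : (n / (b - a)) * (((u - a) / (m - a)) ^ (n - 1)) = 0 := by
      simp [h, Real.zero_rpow hn1]
    rw [e'] at hL
    rw [e]
    exact glue_hasDerivAt _ _ _ _ u (u - 1) m (by linarith) (by linarith) h0 hL
      (fun x _ _ => F0 x (by linarith)) (fun x _ _ => FL x (by linarith) (by linarith))
  rcases lt_trichotomy u m with k | k | k
  · rw [show ftsp a m b n u = _ from if_pos ⟨h, k.le⟩]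
    exact glue_hasDerivAt _ _ _ _ u a m h k hL hL
      (fun x _ _ => FL x (by linarith) (by linarith))
      (fun x _ _ => FL x (by linarith) (by linarith))
  · rw [show ftsp a m b n u = _ from if_pos ⟨h, k.le⟩]
    have e' : (n / (b - a)) * (((b - u) / (b - m)) ^ (n - 1))
        = (n / (b - a)) * (((u - a) / (m - a)) ^ (n - 1)) := by
      rw [k, div_self hma, div_self hbm]
    rw [e'] at hR
    exact glue_hasDerivAt _ _ _ _ u a b h (by linarith) hL hR
      (fun x _ _ => FL x (by linarith) (by linarith))
      (fun x _ _ => FR x (by linarith) (by linarith))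
  rcases lt_trichotomy u b with l | l | l
  · have e : ftsp a m b n u = (n / (b - a)) * (((b - u) / (b - m)) ^ (n - 1)) := by
      simp [ftsp, k.not_ge, k.le, l]
    rw [e]
    exact glue_hasDerivAt _ _ _ _ u m b k l hR hR
      (fun x _ _ => FR x (by linarith) (by linarith))
      (fun x _ _ => FR x (by linarith) (by linarith))
  · have e : ftsp a m b n u = 0 := by
      simp [ftsp, k.not_ge, l.ge.not_gt]
    have e' : (n / (b - a)) * (((b - u) / (b - m)) ^ (n - 1)) = 0 := by
      simp [l, Real.zero_rpow hn1]
    rw [e'] at hR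
    rw [e]
    exact glue_hasDerivAt _ _ _ _ u m (u + 1) k (by linarith) hR h1
      (fun x _ _ => FR x (by linarith) (by linarith)) (fun x _ _ => F1 x (by linarith))
  · have e : ftsp a m b n u = 0 := by
      simp [ftsp, k.not_ge, l.le.not_gt]
    rw [e]
    exact glue_hasDerivAt _ _ _ _ u b (u + 1) l (by linarith) h1 h1
      (fun x _ _ => F1 x (by linarith)) (fun x _ _ => F1 x (by linarith))
end

section
/- (Exact representation of segmentation functions.) Let T ≥ 2 and K ≥ 2 be integers and let ζ be a segmentation function from {1,...,T} onto {1,...,K}. Then for every power n > 1 there exist modes 0 < m_1 < ⋯ < m_{K−1} < 1 such that, with width w := 1/(T−1), the TSP-based warping function γ_TSP(·; m) exactly represents ζ with respect to the unit grid: γ_TSP(u_t; m) = (ζ(t)−1)/(K−1) for every t = 1,...,T. (One may take m_k := (u_{τ_k} + u_{τ_k−1})/2 where τ_k is the k-th change point of ζ, i.e., ζ(τ_k−1) = k and ζ(τ_k) = k+1.) -/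
/-- Left support endpoint of the three-parameter TSP distribution `TSP(m, w, n)`. -/
noncomputable def tspA (m w : ℝ) : ℝ := max 0 (min (1 - w) (m - w / 2))

/-- Right support endpoint of the three-parameter TSP distribution `TSP(m, w, n)`. -/
noncomputable def tspB (m w : ℝ) : ℝ := min 1 (tspA m w + w)

/-- Cdf of the three-parameter TSP distribution `TSP(m, w, n)`. -/
noncomputable def Ftsp3 (m w n : ℝ) (u : ℝ) : ℝ := Ftsp (tspA m w) m (tspB m w) n u

/-- The TSP-based warping function with `K` segments, modes `m 1 < ⋯ < m (K-1)`,
width `w` and power `n`. -/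
noncomputable def gammaTSP (K : ℕ) (m : ℕ → ℝ) (w n : ℝ) (u : ℝ) : ℝ :=
  (1 / ((K : ℝ) - 1)) * ∑ k ∈ Finset.Icc 1 (K - 1), Ftsp3 (m k) w n u

theorem exists_change_point (T K : ℕ) (hT : 2 ≤ T) (ζ : ℕ → ℕ)
    (hfirst : ζ 1 = 1) (hlast : ζ T = K)
    (hstep : ∀ t, 1 ≤ t → t < T → ζ (t + 1) ≤ ζ t + 1)
    (k : ℕ) (hk : 1 ≤ k) (hkK : k < K) :
    ∃ s, 1 ≤ s ∧ s < T ∧ ζ s = k ∧ ζ (s + 1) = k + 1 := by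
  classical
  have hex : ∃ t, 1 ≤ t ∧ t ≤ T ∧ k < ζ t := ⟨T, by omega, le_refl _, by omega⟩
  obtain ⟨h1, h2, h3⟩ := Nat.find_spec hex
  have hmin := fun s => Nat.find_min (m := s) hex
  generalize Nat.find hex = t at *
  have ht1 : t ≠ 1 := by
    rintro rfl
    omega
  obtain ⟨s, rfl⟩ : ∃ s, t = s + 1 := ⟨t - 1, by omega⟩
  have h4 := hmin s (by omega)
  have h5 := hstep s (by omega) (by omega)
  have h6 : ζ s ≤ k := by
    by_contra hcon
    exact h4 ⟨by omega, by omega, by omega⟩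
  exact ⟨s, by omega, by omega, by omega, by omega⟩

theorem Ftsp3_grid (T s t : ℕ) (hs : 1 ≤ s) (hsT : s < T) (n : ℝ) (hn : 1 < n) :
    Ftsp3 (((s : ℝ) - 1 / 2) / ((T : ℝ) - 1)) (1 / ((T : ℝ) - 1)) n
      (((t : ℝ) - 1) / ((T : ℝ) - 1)) = if s < t then 1 else 0 := by
  have hs' : (1 : ℝ) ≤ s := by exact_mod_cast hs
  have hsT' : (s : ℝ) + 1 ≤ T := by exact_mod_cast hsT
  have hN : (0 : ℝ) < (T : ℝ) - 1 := by linarith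
  have hA : tspA (((s : ℝ) - 1 / 2) / ((T : ℝ) - 1)) (1 / ((T : ℝ) - 1))
      = ((s : ℝ) - 1) / ((T : ℝ) - 1) := by
    have e1 : ((s : ℝ) - 1 / 2) / ((T : ℝ) - 1) - 1 / ((T : ℝ) - 1) / 2
        = ((s : ℝ) - 1) / ((T : ℝ) - 1) := by
      field_simp
      ring
    have e2 : 1 - 1 / ((T : ℝ) - 1) = ((T : ℝ) - 2) / ((T : ℝ) - 1) := by
      field_simp
      ring
    unfold tspA
    rw [e1, e2, min_eq_right, max_eq_right]
    · exact div_nonneg (by linarith) hN.le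
    · exact div_le_div_of_nonneg_right (by linarith) hN.le
  have hB : tspB (((s : ℝ) - 1 / 2) / ((T : ℝ) - 1)) (1 / ((T : ℝ) - 1))
      = (s : ℝ) / ((T : ℝ) - 1) := by
    unfold tspB
    rw [hA, ← add_div, sub_add_cancel, min_eq_right]
    rw [div_le_one hN]
    linarith
  unfold Ftsp3 Ftsp
  rw [hA, hB]
  simp only [div_le_div_iff_of_pos_right hN]
  by_cases h : s < t
  · have h' : (s : ℝ) + 1 ≤ t := by exact_mod_cast h
    rw [if_neg (by linarith), if_neg (by linarith), if_pos h]
    split_ifs with h2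
    · have : (t : ℝ) - 1 = s := by linarith
      rw [this, sub_self, zero_div, Real.zero_rpow (by linarith)]
      simp
    · rfl
  · have h' : (t : ℝ) ≤ s := by exact_mod_cast not_lt.mp h
    rw [if_pos (by linarith), if_neg h]

/-- Exact representation of segmentation functions: Let `T ≥ 2` and
`K ≥ 2` be integers and let `ζ : {1,...,T} → {1,...,K}` be a segmentation function
(monotonically nondecreasing, `ζ 1 = 1`, `ζ T = K`, increasing by at most one per step).
Then for every power `n > 1` there exist modes `0 < m 1 < ⋯ < m (K−1) < 1` such that,
with width `w := 1/(T−1)`, the TSP-based warping function `γ_TSP(·; m)` exactly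
represents `ζ` with respect to the unit grid `u t = (t−1)/(T−1)`:
`γ_TSP(u t; m) = (ζ t − 1)/(K−1)` for every `t = 1,...,T`. -/
theorem gammaTSP_exactly_represents (T K : ℕ) (hT : 2 ≤ T) (hK : 2 ≤ K)
    (ζ : ℕ → ℕ)
    (hmono : ∀ s t, 1 ≤ s → s ≤ t → t ≤ T → ζ s ≤ ζ t)
    (hrange : ∀ t, 1 ≤ t → t ≤ T → 1 ≤ ζ t ∧ ζ t ≤ K)
    (hfirst : ζ 1 = 1) (hlast : ζ T = K)
    (hstep : ∀ t, 1 ≤ t → t < T → ζ (t + 1) ≤ ζ t + 1)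
    (n : ℝ) (hn : 1 < n) :
    ∃ m : ℕ → ℝ,
      (∀ k, 1 ≤ k → k ≤ K - 1 → m k ∈ Set.Ioo (0 : ℝ) 1) ∧
      (∀ j k, 1 ≤ j → j < k → k ≤ K - 1 → m j < m k) ∧
      ∀ t, 1 ≤ t → t ≤ T →
        gammaTSP K m (1 / ((T : ℝ) - 1)) n (((t : ℝ) - 1) / ((T : ℝ) - 1))
          = ((ζ t : ℝ) - 1) / ((K : ℝ) - 1) := by
  have hch : ∀ k, ∃ s, 1 ≤ k → k < K → 1 ≤ s ∧ s < T ∧ ζ s = k ∧ ζ (s + 1) = k + 1 := by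
    intro k
    by_cases hk : 1 ≤ k ∧ k < K
    · obtain ⟨s, hs⟩ := exists_change_point T K hT ζ hfirst hlast hstep k hk.1 hk.2
      exact ⟨s, fun _ _ => hs⟩
    · exact ⟨0, fun h1 h2 => absurd ⟨h1, h2⟩ hk⟩
  choose σ hσ using hch
  have hT' : (2 : ℝ) ≤ T := by exact_mod_cast hT
  have hN : (0 : ℝ) < (T : ℝ) - 1 := by linarith
  refine ⟨fun k => ((σ k : ℝ) - 1 / 2) / ((T : ℝ) - 1), ?_, ?_, ?_⟩
  · intro k hk hkK
    obtain ⟨h1, h2, -, -⟩ := hσ k hk (by omega)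
    have h1' : (1 : ℝ) ≤ σ k := by exact_mod_cast h1
    have h2' : (σ k : ℝ) + 1 ≤ T := by exact_mod_cast h2
    constructor
    · exact div_pos (by linarith) hN
    · show _ / _ < (1 : ℝ)
      rw [div_lt_one hN]
      linarith
  · intro j k hj hjk hkK
    obtain ⟨h1, h2, h3, -⟩ := hσ j hj (by omega)
    obtain ⟨g1, g2, g3, -⟩ := hσ k (by omega) (by omega)
    have hlt : σ j < σ k := by
      by_contra hcon
      have := hmono (σ k) (σ j) g1 (by omega) h2.le
      omega
    have hlt' : (σ j : ℝ) < σ k := by exact_mod_cast hlt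
    exact div_lt_div_of_pos_right (by linarith) hN
  · intro t ht1 htT
    obtain ⟨hz1, hz2⟩ := hrange t ht1 htT
    unfold gammaTSP
    have hsum : ∑ k ∈ Finset.Icc 1 (K - 1),
        Ftsp3 (((σ k : ℝ) - 1 / 2) / ((T : ℝ) - 1)) (1 / ((T : ℝ) - 1)) n
          (((t : ℝ) - 1) / ((T : ℝ) - 1)) = (ζ t : ℝ) - 1 := by
      have hc : ∀ k ∈ Finset.Icc 1 (K - 1),
          Ftsp3 (((σ k : ℝ) - 1 / 2) / ((T : ℝ) - 1)) (1 / ((T : ℝ) - 1)) n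
            (((t : ℝ) - 1) / ((T : ℝ) - 1)) = if k < ζ t then 1 else 0 := by
        intro k hk
        rw [Finset.mem_Icc] at hk
        obtain ⟨h1, h2, h3, h4⟩ := hσ k hk.1 (by omega)
        rw [Ftsp3_grid T (σ k) t h1 h2 n hn]
        have hiff : σ k < t ↔ k < ζ t := by
          constructor
          · intro h
            have := hmono (σ k + 1) t (by omega) h htT
            omega
          · intro h
            by_contra hcon
            have := hmono t (σ k) ht1 (by omega) h2.le
            omega
        simp only [hiff]
      rw [Finset.sum_congr rfl hc, Finset.sum_boole]
      have hf : (Finset.Icc 1 (K - 1)).filter (fun k => k < ζ t) = Finset.Ico 1 (ζ t) := by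
        ext k
        simp only [Finset.mem_filter, Finset.mem_Icc, Finset.mem_Ico]
        omega
      rw [hf, Nat.card_Ico, Nat.cast_sub hz1, Nat.cast_one]
    rw [hsum, one_div, inv_mul_eq_div]
end
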